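/- arXiv:2302.10626 — 7 statements merged into one kernel-verified Lean document; each statement's English description precedes it below -/
import Mathlib

section
/- Let q, c be vectors in a real inner product space, r ≥ 0, and let S be a nonempty finite set of vectors such that ‖x − c‖ ≤ r for all x ∈ S. Then min over x ∈ S of |⟨x, q⟩| is at least max(|⟨q, c⟩| − ‖q‖·r, 0). (Theorem 2: node-level ball bound.) -/
open RealInnerProductSpace

/-- Theorem 2 (Node-level ball bound): for a nonempty finite set `S` of points with
`‖x - c‖ ≤ r` for all `x ∈ S`, the minimum of `|⟪x, q⟫|` over `x ∈ S` is at least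
`max (|⟪q, c⟫| - ‖q‖ * r) 0`. -/
theorem node_level_ball_bound
    {E : Type*} [NormedAddCommGroup E] [InnerProductSpace ℝ E]
    (q c : E) (r : ℝ) (hr : 0 ≤ r)
    (S : Finset E) (hS : S.Nonempty) (hball : ∀ x ∈ S, ‖x - c‖ ≤ r) :
    S.inf' hS (fun x => |⟪x, q⟫|) ≥ max (|⟪q, c⟫| - ‖q‖ * r) 0 := by
  refine Finset.le_inf' _ _ fun x hx => max_le ?_ (abs_nonneg _)
  have h1 := abs_real_inner_le_norm q (x - c)
  have h2 := mul_le_mul_of_nonneg_left (hball x hx) (norm_nonneg q)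
  rw [inner_sub_right, real_inner_comm x q] at h1
  have h3 := abs_sub_abs_le_abs_sub (inner ℝ q c) (inner ℝ x q)
  rw [abs_sub_comm] at h3
  linarith
end

section
/- Let q, c, x be nonzero vectors in a real inner product space, let θ be the angle between q and c and φ the angle between x and c (angles taken in [0, π]). If cos(θ + φ) > 0, cos θ > 0, and cos φ > 0, then |⟨x, q⟩| ≥ ‖x‖·‖q‖·cos(θ + φ). (First case of Theorem 3, the point-level cone bound.) -/
open RealInnerProductSpace Real InnerProductGeometry

/-- First case of Theorem 3 (point-level cone bound): if `cos (θ + φ) > 0`,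
`cos θ > 0` and `cos φ > 0`, where `θ` is the angle between `q` and `c` and `φ` is
the angle between `x` and `c`, then `|⟪x, q⟫| ≥ ‖x‖ * ‖q‖ * cos (θ + φ)`. -/
theorem point_level_cone_bound_case1
    {E : Type*} [NormedAddCommGroup E] [InnerProductSpace ℝ E]
    (q c x : E) (hq : q ≠ 0) (hc : c ≠ 0) (hx : x ≠ 0)
    (θ φ : ℝ) (hθ : θ = angle q c) (hφ : φ = angle x c)
    (h1 : Real.cos (θ + φ) > 0) (h2 : Real.cos θ > 0) (h3 : Real.cos φ > 0) :
    |⟪x, q⟫| ≥ ‖x‖ * ‖q‖ * Real.cos (θ + φ) := by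
  have key : ∀ t : ℝ, 0 ≤ t → t ≤ Real.pi → 0 < Real.cos t → t ≤ Real.pi / 2 := by
    intro t _ ht hc
    by_contra h
    push Not at h
    have := Real.cos_nonpos_of_pi_div_two_le_of_le h.le (by linarith [Real.pi_pos])
    linarith
  have hθ' := key θ (hθ ▸ angle_nonneg q c) (hθ ▸ angle_le_pi q c) h2
  have hφ' := key φ (hφ ▸ angle_nonneg x c) (hφ ▸ angle_le_pi x c) h3
  have tri : angle x q ≤ θ + φ := by
    have := InnerProductGeometry.angle_le_angle_add_angle x c q
    rw [angle_comm c q] at this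
    linarith
  have hcos : Real.cos (θ + φ) ≤ Real.cos (angle x q) :=
    Real.cos_le_cos_of_nonneg_of_le_pi (angle_nonneg x q) (by linarith) tri
  have e := cos_angle_mul_norm_mul_norm x q
  have hm := mul_le_mul_of_nonneg_left hcos (mul_nonneg (norm_nonneg x) (norm_nonneg q))
  have ha := le_abs_self ⟪x, q⟫
  linarith
end

section
/- Let q, c, x be nonzero vectors in a real inner product space, let θ be the angle between q and c and φ the angle between x and c (angles taken in [0, π]). If cos(|θ − φ|) < 0, then |⟨x, q⟩| ≥ −‖x‖·‖q‖·cos(|θ − φ|). (Second case of Theorem 3, the point-level cone bound.) -/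
open RealInnerProductSpace Real InnerProductGeometry

/-- Second case of Theorem 3 (point-level cone bound): if `cos |θ - φ| < 0`,
where `θ` is the angle between `q` and `c` and `φ` is the angle between `x` and `c`,
then `|⟪x, q⟫| ≥ -(‖x‖ * ‖q‖ * cos |θ - φ|)`. -/
theorem point_level_cone_bound_case2
    {E : Type*} [NormedAddCommGroup E] [InnerProductSpace ℝ E]
    (q c x : E) (hq : q ≠ 0) (hc : c ≠ 0) (hx : x ≠ 0)
    (θ φ : ℝ) (hθ : θ = angle q c) (hφ : φ = angle x c)
    (h1 : Real.cos |θ - φ| < 0) :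
    |⟪x, q⟫| ≥ -(‖x‖ * ‖q‖ * Real.cos |θ - φ|) := by
  have t1 : angle q c ≤ angle q x + angle x c := angle_le_angle_add_angle q x c
  have t2 : angle x c ≤ angle x q + angle q c := angle_le_angle_add_angle x q c
  rw [angle_comm q x] at t1
  have h2 : |θ - φ| ≤ angle x q := by
    rw [hθ, hφ, abs_le]; constructor <;> linarith
  have h3 : Real.cos (angle x q) ≤ Real.cos |θ - φ| :=
    Real.cos_le_cos_of_nonneg_of_le_pi (abs_nonneg _) (angle_le_pi x q) h2
  have h4 := mul_le_mul_of_nonneg_left h3 (mul_nonneg (norm_nonneg x) (norm_nonneg q))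
  have h5 := cos_angle_mul_norm_mul_norm x q
  have h6 := neg_le_abs (⟪x, q⟫)
  linarith
end

section
/- Let q, c, x be nonzero vectors in a real inner product space, let θ be the angle between q and c and φ the angle between x and c (angles taken in [0, π]). Define B = ‖x‖·‖q‖·cos(θ + φ) if cos(θ + φ) > 0, cos θ > 0 and cos φ > 0; B = −‖x‖·‖q‖·cos(|θ − φ|) if cos(|θ − φ|) < 0; and B = 0 otherwise. Then |⟨x, q⟩| ≥ B. (Theorem 3: point-level cone bound, full piecewise statement.) -/
open RealInnerProductSpace Real InnerProductGeometry

/-- Theorem 3 (Point-level cone bound, full piecewise statement): with `θ` the angle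
between `q` and `c` and `φ` the angle between `x` and `c`, the absolute inner product
`|⟪x, q⟫|` is at least the piecewise bound `B`. -/
theorem point_level_cone_bound
    {E : Type*} [NormedAddCommGroup E] [InnerProductSpace ℝ E]
    (q c x : E) (hq : q ≠ 0) (hc : c ≠ 0) (hx : x ≠ 0)
    (θ φ : ℝ) (hθ : θ = angle q c) (hφ : φ = angle x c)
    (B : ℝ)
    (hB : B = if Real.cos (θ + φ) > 0 ∧ Real.cos θ > 0 ∧ Real.cos φ > 0 then
                ‖x‖ * ‖q‖ * Real.cos (θ + φ)
              else if Real.cos |θ - φ| < 0 then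
                -(‖x‖ * ‖q‖ * Real.cos |θ - φ|)
              else 0) :
    |⟪x, q⟫| ≥ B := by
  have hin : ⟪x, q⟫ = ‖x‖ * ‖q‖ * Real.cos (angle x q) := by
    rw [← cos_angle_mul_norm_mul_norm x q]; ring
  have hN : 0 ≤ ‖x‖ * ‖q‖ := by positivity
  have h0 : 0 ≤ θ := hθ ▸ angle_nonneg q c
  have h1 : θ ≤ π := hθ ▸ angle_le_pi q c
  have h2 : 0 ≤ φ := hφ ▸ angle_nonneg x c
  have h3 : φ ≤ π := hφ ▸ angle_le_pi x c
  have t1 : angle x q ≤ φ + θ := by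
    have := angle_le_angle_add_angle x c q
    rwa [angle_comm c q, ← hθ, ← hφ] at this
  have t2 : θ ≤ angle x q + φ := by
    have := angle_le_angle_add_angle q x c
    rwa [angle_comm q x, ← hθ, ← hφ] at this
  have t3 : φ ≤ angle x q + θ := by
    have := angle_le_angle_add_angle x q c
    rwa [← hθ, ← hφ] at this
  rw [hB]
  split_ifs with hA hC
  · obtain ⟨_, ha, hb⟩ := hA
    have a1 : θ < π / 2 := by
      by_contra! h
      exact absurd (Real.cos_nonpos_of_pi_div_two_le_of_le h (by linarith)) (not_le.2 ha)
    have a2 : φ < π / 2 := by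
      by_contra! h
      exact absurd (Real.cos_nonpos_of_pi_div_two_le_of_le h (by linarith)) (not_le.2 hb)
    have hcos : Real.cos (θ + φ) ≤ Real.cos (angle x q) :=
      Real.cos_le_cos_of_nonneg_of_le_pi (angle_nonneg x q) (by linarith) (by linarith)
    have := mul_le_mul_of_nonneg_left hcos hN
    rw [← hin] at this
    exact this.trans (le_abs_self _)
  · have hcos : Real.cos (angle x q) ≤ Real.cos |θ - φ| :=
      Real.cos_le_cos_of_nonneg_of_le_pi (abs_nonneg _) (angle_le_pi x q)
        (abs_le.2 ⟨by linarith, by linarith⟩)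
    have := mul_le_mul_of_nonneg_left hcos hN
    rw [← hin] at this
    exact (neg_le_neg this).trans (neg_le_abs _)
  · exact abs_nonneg _
end

section
/- Let x, c be nonzero vectors in a real inner product space, let φ be the angle between x and c (taken in [0, π]), and let θ ∈ [0, π]. Then ‖x‖·cos(θ + φ) ≥ ‖c‖·cos θ − ‖x − c‖. (Key inequality in the proof of Theorem 4, comparing the cone bound with the ball bound; proved via the Cauchy–Schwarz inequality and the identity (‖x‖ sin φ)² + (‖c‖ − ‖x‖ cos φ)² = ‖x − c‖².) -/
open RealInnerProductSpace Real InnerProductGeometry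

/-- Key inequality in the proof of Theorem 4, comparing the cone bound with the ball
bound: for `θ ∈ [0, π]` and `φ` the angle between `x` and `c`,
`‖x‖ * cos (θ + φ) ≥ ‖c‖ * cos θ - ‖x - c‖`. -/
theorem cone_bound_ge_ball_bound_key
    {E : Type*} [NormedAddCommGroup E] [InnerProductSpace ℝ E]
    (x c : E) (hx : x ≠ 0) (hc : c ≠ 0)
    (φ : ℝ) (hφ : φ = angle x c)
    (θ : ℝ) (hθ0 : 0 ≤ θ) (hθπ : θ ≤ Real.pi) :
    ‖x‖ * Real.cos (θ + φ) ≥ ‖c‖ * Real.cos θ - ‖x - c‖ := by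
  have h1 : ‖x - c‖ ^ 2 = ‖x‖ ^ 2 - 2 * (‖x‖ * ‖c‖ * Real.cos φ) + ‖c‖ ^ 2 := by
    rw [norm_sub_sq_real, ← cos_angle_mul_norm_mul_norm x c, hφ]
    ring
  have h2 := Real.sin_sq_add_cos_sq φ
  have h3 := Real.sin_sq_add_cos_sq θ
  have h4 : (‖x‖ * Real.sin φ) ^ 2 + (‖c‖ - ‖x‖ * Real.cos φ) ^ 2 = ‖x - c‖ ^ 2 := by
    rw [h1]
    linear_combination ‖x‖ ^ 2 * h2
  have h5 : (‖c‖ - ‖x‖ * Real.cos φ) * Real.cos θ + ‖x‖ * Real.sin φ * Real.sin θ ≤ ‖x - c‖ := by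
    refine abs_le_of_sq_le_sq' ?_ (norm_nonneg _) |>.2
    rw [← h4]
    generalize ‖x‖ * Real.sin φ = b
    generalize ‖c‖ - ‖x‖ * Real.cos φ = a
    have h6 : b ^ 2 + a ^ 2 = (a * Real.cos θ + b * Real.sin θ) ^ 2
        + (a * Real.sin θ - b * Real.cos θ) ^ 2 := by
      linear_combination (-(a ^ 2 + b ^ 2)) * h3
    rw [h6]
    exact le_add_of_nonneg_right (sq_nonneg _)
  rw [Real.cos_add]
  linarith
end

section
/- Let x, c be nonzero vectors in a real inner product space, let φ be the angle between x and c (taken in [0, π]), and let θ ∈ [0, π]. Then ‖x‖·cos(θ − φ) ≤ ‖c‖·cos θ + ‖x − c‖. (Companion key inequality in the proof of Theorem 4, comparing the cone bound with the ball bound in the negative-inner-product case.) -/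
open RealInnerProductSpace Real InnerProductGeometry

/-- Companion key inequality in the proof of Theorem 4 (negative-inner-product case):
for `θ ∈ [0, π]` and `φ` the angle between `x` and `c`,
`‖x‖ * cos (θ - φ) ≤ ‖c‖ * cos θ + ‖x - c‖`. -/
theorem cone_bound_le_ball_bound_key
    {E : Type*} [NormedAddCommGroup E] [InnerProductSpace ℝ E]
    (x c : E) (hx : x ≠ 0) (hc : c ≠ 0)
    (φ : ℝ) (hφ : φ = angle x c)
    (θ : ℝ) (hθ0 : 0 ≤ θ) (hθπ : θ ≤ Real.pi) :
    ‖x‖ * Real.cos (θ - φ) ≤ ‖c‖ * Real.cos θ + ‖x - c‖ := by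
  have h1 : ‖x - c‖ ^ 2 = ‖x‖ ^ 2 + ‖c‖ ^ 2 - 2 * (‖x‖ * ‖c‖ * Real.cos φ) := by
    have h := norm_sub_sq_real x c
    have h2 := cos_angle_mul_norm_mul_norm x c
    rw [← hφ] at h2
    rw [h, ← h2]
    ring
  have h3 : ‖x‖ * Real.cos (θ - φ) - ‖c‖ * Real.cos θ ≤ ‖x - c‖ := by
    refine abs_le_of_sq_le_sq' ?_ (norm_nonneg _) |>.2
    rw [h1, Real.cos_sub]
    have e1 := Real.sin_sq_add_cos_sq θ
    have e2 := Real.sin_sq_add_cos_sq φ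
    have key : ‖x‖ ^ 2 + ‖c‖ ^ 2 - 2 * (‖x‖ * ‖c‖ * Real.cos φ) -
        (‖x‖ * (Real.cos θ * Real.cos φ + Real.sin θ * Real.sin φ) - ‖c‖ * Real.cos θ) ^ 2 =
        ((‖x‖ * Real.cos φ - ‖c‖) * Real.sin θ - ‖x‖ * Real.sin φ * Real.cos θ) ^ 2 := by
      linear_combination (-((‖x‖ * Real.cos φ - ‖c‖) ^ 2 + (‖x‖ * Real.sin φ) ^ 2)) * e1
        - ‖x‖ ^ 2 * e2
    nlinarith [sq_nonneg ((‖x‖ * Real.cos φ - ‖c‖) * Real.sin θ - ‖x‖ * Real.sin φ * Real.cos θ)]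
  linarith
end

section
/- Let q, c, x be nonzero vectors in a real inner product space, let θ be the angle between q and c and φ the angle between x and c (angles taken in [0, π]), and set r_x = ‖x − c‖. Define the point-level cone bound B_cone = ‖x‖·‖q‖·cos(θ + φ) if cos(θ + φ) > 0, cos θ > 0 and cos φ > 0; B_cone = −‖x‖·‖q‖·cos(|θ − φ|) if cos(|θ − φ|) < 0; and B_cone = 0 otherwise. Define the point-level ball bound B_ball = max(|⟨q, c⟩| − ‖q‖·r_x, 0). Then B_cone ≥ B_ball. (Theorem 4: the point-level cone bound is tighter than the point-level ball bound.) -/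
open RealInnerProductSpace Real InnerProductGeometry

/-- Theorem 4: the point-level cone bound is tighter than the point-level ball bound.
With `θ` the angle between `q` and `c`, `φ` the angle between `x` and `c`, and
`r_x = ‖x - c‖`, the piecewise cone bound `B_cone` dominates the ball bound
`B_ball = max (|⟪q, c⟫| - ‖q‖ * r_x) 0`. -/
theorem cone_bound_tighter_than_ball_bound
    {E : Type*} [NormedAddCommGroup E] [InnerProductSpace ℝ E]
    (q c x : E) (hq : q ≠ 0) (hc : c ≠ 0) (hx : x ≠ 0)
    (θ φ rx : ℝ) (hθ : θ = angle q c) (hφ : φ = angle x c) (hrx : rx = ‖x - c‖)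
    (Bcone Bball : ℝ)
    (hBcone : Bcone = if Real.cos (θ + φ) > 0 ∧ Real.cos θ > 0 ∧ Real.cos φ > 0 then
                ‖x‖ * ‖q‖ * Real.cos (θ + φ)
              else if Real.cos |θ - φ| < 0 then
                -(‖x‖ * ‖q‖ * Real.cos |θ - φ|)
              else 0)
    (hBball : Bball = max (|⟪q, c⟫| - ‖q‖ * rx) 0) :
    Bcone ≥ Bball := by
  have hQ : 0 ≤ ‖q‖ := norm_nonneg q
  have hX : 0 ≤ ‖x‖ := norm_nonneg x
  have hr : 0 ≤ rx := hrx ▸ norm_nonneg _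
  have hqc : ⟪q, c⟫ = ‖q‖ * (‖c‖ * Real.cos θ) := by
    rw [hθ, ← cos_angle_mul_norm_mul_norm q c]; ring
  have hr2 : rx ^ 2 = ‖x‖ ^ 2 + ‖c‖ ^ 2 - 2 * (‖x‖ * ‖c‖ * Real.cos φ) := by
    rw [hrx, norm_sub_sq_real, ← cos_angle_mul_norm_mul_norm x c, hφ]; ring
  have hsθ : 0 ≤ Real.sin θ := hθ ▸ sin_angle_nonneg q c
  have hsφ : 0 ≤ Real.sin φ := hφ ▸ sin_angle_nonneg x c
  have h1 := Real.sin_sq_add_cos_sq θ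
  have h2 := Real.sin_sq_add_cos_sq φ
  have hplus : |‖c‖ * Real.cos θ - ‖x‖ * Real.cos (θ + φ)| ≤ rx := by
    refine abs_le_of_sq_le_sq ?_ hr
    have : rx ^ 2 - (‖c‖ * Real.cos θ - ‖x‖ * Real.cos (θ + φ)) ^ 2
        = (‖c‖ * Real.sin θ - ‖x‖ * Real.sin (θ + φ)) ^ 2 := by
      rw [hr2, Real.cos_add, Real.sin_add]
      linear_combination (-‖c‖^2 - ‖x‖^2 * (Real.sin φ ^ 2 + Real.cos φ ^ 2) + 2 * ‖x‖ * ‖c‖ * Real.cos φ) * h1 - ‖x‖^2 * h2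
    nlinarith [sq_nonneg (‖c‖ * Real.sin θ - ‖x‖ * Real.sin (θ + φ))]
  have hminus : |‖c‖ * Real.cos θ - ‖x‖ * Real.cos (θ - φ)| ≤ rx := by
    refine abs_le_of_sq_le_sq ?_ hr
    have : rx ^ 2 - (‖c‖ * Real.cos θ - ‖x‖ * Real.cos (θ - φ)) ^ 2
        = (‖c‖ * Real.sin θ - ‖x‖ * Real.sin (θ - φ)) ^ 2 := by
      rw [hr2, Real.cos_sub, Real.sin_sub]
      linear_combination (-‖c‖^2 - ‖x‖^2 * (Real.sin φ ^ 2 + Real.cos φ ^ 2) + 2 * ‖x‖ * ‖c‖ * Real.cos φ) * h1 - ‖x‖^2 * h2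
    nlinarith [sq_nonneg (‖c‖ * Real.sin θ - ‖x‖ * Real.sin (θ - φ))]
  rw [abs_le] at hplus hminus
  have hC : 0 ≤ ‖c‖ := norm_nonneg c
  have key : ∀ B : ℝ, 0 ≤ B → |‖c‖ * Real.cos θ| - rx ≤ B → Bball ≤ ‖q‖ * B := by
    intro B hB h
    rw [hBball, hqc, abs_mul, abs_of_nonneg hQ, ← mul_sub]
    exact max_le (mul_le_mul_of_nonneg_left h hQ) (mul_nonneg hQ hB)
  rw [Real.cos_abs] at hBcone
  rw [ge_iff_le, hBcone]
  split_ifs with ha hb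
  · obtain ⟨h3, h4, h5⟩ := ha
    have := key (‖x‖ * Real.cos (θ + φ)) (by positivity)
      (by rw [abs_of_nonneg (by positivity)]; linarith)
    linarith
  · have hn : ‖x‖ * Real.cos (θ - φ) ≤ 0 := mul_nonpos_of_nonneg_of_nonpos hX hb.le
    have := key (-(‖x‖ * Real.cos (θ - φ))) (by linarith)
      (by rw [sub_le_iff_le_add, abs_le]; constructor <;> linarith)
    linarith
  · have hn : 0 ≤ ‖x‖ * Real.cos (θ - φ) := mul_nonneg hX (not_lt.mp hb)
    have := key 0 le_rfl (by
      rcases le_or_gt (Real.cos θ) 0 with h | h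
      · rw [abs_of_nonpos (mul_nonpos_of_nonneg_of_nonpos hC h)]; linarith
      · have h6 : Real.cos (θ + φ) ≤ 0 := by
          by_contra h7
          push Not at h7
          apply ha ⟨h7, h, ?_⟩
          by_contra h8
          push Not at h8
          rw [Real.cos_add] at h7
          nlinarith [mul_nonneg hsθ hsφ, mul_nonneg h.le (neg_nonneg.mpr h8)]
        have := mul_nonpos_of_nonneg_of_nonpos hX h6
        rw [abs_of_nonneg (by positivity)]; linarith)
    linarith
end
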